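/- For every SLT grammar G there exists a straight-line program (SLP) of size O(|G|) that generates the serialization (the pre-order traversal string of opening and closing labeled brackets) of the tree val(G). -/

import Mathlib

/-- Trees over terminal labels `L`, nonterminals `N`, the leaf symbol `_`
(constructor `leaf`) and parameters `y_i` (constructor `param i`, 1-indexed).
Terminal-labeled nodes have exactly two children; a nonterminal node has a
list of children (its length being constrained by `ArityOk`). -/
inductive PTree (L N : Type) where
  | leaf : PTree L N
  | param : ℕ → PTree L N
  | term : L → PTree L N → PTree L N → PTree L N
  | nt : N → List (PTree L N) → PTree L N

namespace PTree

variable {L N : Type}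

/-- The pre-order list of parameter indices occurring in a tree. -/
def paramList : PTree L N → List ℕ
  | .leaf => []
  | .param i => [i]
  | .term _ l r => paramList l ++ paramList r
  | .nt _ ts => (ts.attach.map (fun t => paramList t.1)).flatten
decreasing_by
  all_goals simp_wf
  all_goals try omega
  all_goals (have := List.sizeOf_lt_of_mem t.2; omega)

/-- The number of nodes of a tree. -/
def nodeCount : PTree L N → ℕ
  | .leaf => 1
  | .param _ => 1
  | .term _ l r => 1 + nodeCount l + nodeCount r
  | .nt _ ts => 1 + (ts.attach.map (fun t => nodeCount t.1)).sum
decreasing_by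
  all_goals simp_wf
  all_goals try omega
  all_goals (have := List.sizeOf_lt_of_mem t.2; omega)

/-- Arities are respected: every nonterminal node labeled `A` has exactly
`rank A` children. -/
inductive ArityOk (rank : N → ℕ) : PTree L N → Prop
  | leaf : ArityOk rank .leaf
  | param (i : ℕ) : ArityOk rank (.param i)
  | term (a : L) {l r : PTree L N} :
      ArityOk rank l → ArityOk rank r → ArityOk rank (.term a l r)
  | nt (A : N) {ts : List (PTree L N)} :
      ts.length = rank A → (∀ t ∈ ts, ArityOk rank t) → ArityOk rank (.nt A ts)

/-- `Occurs B t` holds iff the nonterminal `B` occurs somewhere in `t`. -/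
inductive Occurs (B : N) : PTree L N → Prop
  | here (ts : List (PTree L N)) : Occurs B (.nt B ts)
  | nt (A : N) {ts : List (PTree L N)} {t : PTree L N} :
      t ∈ ts → Occurs B t → Occurs B (.nt A ts)
  | term_left (a : L) {l r : PTree L N} : Occurs B l → Occurs B (.term a l r)
  | term_right (a : L) {l r : PTree L N} : Occurs B r → Occurs B (.term a l r)

/-- Ground trees: binary trees built from terminal symbols and `_`-leaves only
(no nonterminals, no parameters). -/
inductive Ground : PTree L N → Prop
  | leaf : Ground .leaf
  | term (a : L) {l r : PTree L N} : Ground l → Ground r → Ground (.term a l r)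

/-- Substitution of the parameters `y_1, …, y_k` by the trees of `env`
(`y_i` is replaced by the `i`-th entry of `env`). -/
def subst (env : List (PTree L N)) : PTree L N → PTree L N
  | .leaf => .leaf
  | .param i => env.getD (i - 1) .leaf
  | .term a l r => .term a (subst env l) (subst env r)
  | .nt B ts => .nt B (ts.attach.map (fun t => subst env t.1))
decreasing_by
  all_goals simp_wf
  all_goals try omega
  all_goals (have := List.sizeOf_lt_of_mem t.2; omega)

end PTree

open PTree in
/-- A straight-line (linear) tree grammar `G = (N, S, P)`:
each nonterminal `A` of rank `k` has exactly one production `A → P A`, in whose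
right-hand side the parameters `y_1, …, y_k` occur exactly once each and
in this order in pre-order, all arities are respected, and the hierarchical
order `H_G = {(A, B) | B occurs in P A}` is acyclic. -/
structure SLT (L N : Type) where
  rank : N → ℕ
  start : N
  P : N → PTree L N
  rank_start : rank start = 0
  arity : ∀ A, ArityOk rank (P A)
  params : ∀ A, paramList (P A) = List.range' 1 (rank A)
  acyclic : ∀ A, ¬ Relation.TransGen (fun X Y => Occurs Y (P X)) A A

namespace SLT

variable {L N : Type}

/-- One derivation step: replace one occurrence of a subtree `A(t_1, …, t_k)`
(`A` a nonterminal) by `P A` with each parameter `y_i` replaced by `t_i`. -/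
inductive Rw (G : SLT L N) : PTree L N → PTree L N → Prop
  | head (A : N) (ts : List (PTree L N)) :
      Rw G (.nt A ts) (PTree.subst ts (G.P A))
  | term_left {l l' : PTree L N} (a : L) (r : PTree L N) :
      Rw G l l' → Rw G (.term a l r) (.term a l' r)
  | term_right {r r' : PTree L N} (a : L) (l : PTree L N) :
      Rw G r r' → Rw G (.term a l r) (.term a l r')
  | nt_child {t t' : PTree L N} (B : N) (u v : List (PTree L N)) :
      Rw G t t' → Rw G (.nt B (u ++ t :: v)) (.nt B (u ++ t' :: v))

/-- The size of a grammar: the sum of the numbers of edges of all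
right-hand sides. -/
def size [Fintype N] (G : SLT L N) : ℕ :=
  ∑ A : N, (PTree.nodeCount (G.P A) - 1)

end SLT

/-- A straight-line program (SLP): a context-free string grammar over terminal
alphabet `Γ` with nonterminal set `V` in which every nonterminal `v` has
exactly one production `v → P v` and the derivation relation among
nonterminals is acyclic. -/
structure SLP (Γ V : Type) where
  start : V
  P : V → List (Γ ⊕ V)
  acyclic : ∀ v, ¬ Relation.TransGen (fun x y => Sum.inr y ∈ P x) v v

namespace SLP

variable {Γ V : Type}

/-- One derivation step of an SLP: replace one occurrence of a nonterminal by
its right-hand side. -/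
inductive Rw (H : SLP Γ V) : List (Γ ⊕ V) → List (Γ ⊕ V) → Prop
  | step (u : List (Γ ⊕ V)) (v : V) (w : List (Γ ⊕ V)) :
      Rw H (u ++ Sum.inr v :: w) (u ++ H.P v ++ w)

/-- The SLP generates the string `s` (the unique string derivable from its
start nonterminal). -/
def Generates (H : SLP Γ V) (s : List Γ) : Prop :=
  Relation.ReflTransGen (Rw H) [Sum.inr H.start] (s.map Sum.inl)

/-- The size of an SLP: the total length of all right-hand sides. -/
def size [Fintype V] (H : SLP Γ V) : ℕ :=
  ∑ v : V, (H.P v).length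

end SLP

/-- The serialization of a (ground) tree: the string of opening brackets
`<a>` (encoded `(a, false)`) and closing brackets `</a>` (encoded
`(a, true)`) produced by the depth-first left-to-right traversal, the
`_`-leaves contributing nothing. -/
def PTree.serialize {L N : Type} : PTree L N → List (L × Bool)
  | .leaf => []
  | .param _ => []
  | .term a l r => (a, false) :: (serialize l ++ serialize r ++ [(a, true)])
  | .nt _ _ => []

/-- A relation without cycles on a finite type is well-founded in the reverse direction. -/
theorem wellFounded_of_acyclic {α : Type*} [Finite α] {r : α → α → Prop}
    (h : ∀ a, ¬ Relation.TransGen r a a) : WellFounded (fun b a => r a b) := by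
  let s : α → α → Prop := fun b a => Relation.TransGen r a b
  have : IsTrans α s := ⟨fun _ _ _ hab hbc => hbc.trans hab⟩
  have : Std.Irrefl s := ⟨h⟩
  exact Subrelation.wf (fun hab => Relation.TransGen.single hab)
    (Finite.wellFounded_of_trans_of_irrefl s)

/-- The concatenation `g 0 ++ x₁ ++ g 1 ++ x₂ ++ ⋯ ++ xₙ ++ g n`. -/
def interleave {α : Type*} (g : ℕ → List α) : List (List α) → List α
  | [] => g 0
  | x :: xs => g 0 ++ x ++ interleave (fun j => g (j + 1)) xs

theorem interleave_congr {α : Type*} {g g' : ℕ → List α} {xs : List (List α)}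
    (h : ∀ j ≤ xs.length, g j = g' j) : interleave g xs = interleave g' xs := by
  induction xs generalizing g g' with
  | nil => exact h 0 (Nat.zero_le _)
  | cons x xs ih =>
    simp only [interleave]
    rw [h 0 (Nat.zero_le _), ih (fun j hj => h (j + 1) (by simpa using hj))]

theorem flatMap_interleave {α β : Type*} (φ : α → List β) (g : ℕ → List α)
    (xs : List (List α)) :
    (interleave g xs).flatMap φ =
      interleave (fun j => (g j).flatMap φ) (xs.map (List.flatMap φ)) := by
  induction xs generalizing g with
  | nil => rfl
  | cons x xs ih => simp [interleave, ih]

theorem filterMap_interleave {α β : Type*} (φ : α → Option β) (g : ℕ → List α)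
    (hg : ∀ j, (g j).filterMap φ = []) (xs : List (List α)) :
    (interleave g xs).filterMap φ = (xs.map (List.filterMap φ)).flatten := by
  induction xs generalizing g with
  | nil => simp [interleave, hg]
  | cons x xs ih => simp [interleave, hg, ih (fun j => g (j + 1)) (fun j => hg (j + 1))]

theorem countP_interleave {α : Type*} (p : α → Bool) (g : ℕ → List α)
    (hg : ∀ j, (g j).countP p = 1) (xs : List (List α)) :
    (interleave g xs).countP p = 1 + (xs.map (fun x => x.countP p + 1)).sum := by
  induction xs generalizing g with
  | nil => simp [interleave, hg]
  | cons x xs ih =>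
    simp only [interleave, List.countP_append, hg, List.map_cons, List.sum_cons,
      ih (fun j => g (j + 1)) (fun j => hg (j + 1))]
    omega

theorem mem_interleave {α : Type*} {a : α} {g : ℕ → List α} {xs : List (List α)}
    (h : a ∈ interleave g xs) : (∃ j, a ∈ g j) ∨ ∃ x ∈ xs, a ∈ x := by
  induction xs generalizing g with
  | nil => exact .inl ⟨0, h⟩
  | cons x xs ih =>
    simp only [interleave, List.mem_append] at h
    rcases h with (h | h) | h
    · exact .inl ⟨0, h⟩
    · exact .inr ⟨x, List.mem_cons_self, h⟩
    · rcases ih h with ⟨j, hj⟩ | ⟨y, hy, hay⟩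
      · exact .inl ⟨j + 1, hj⟩
      · exact .inr ⟨y, List.mem_cons_of_mem _ hy, hay⟩

/-- The `j`-th maximal block of left entries of a list, the blocks being separated by
the right entries. -/
def block {α β : Type*} : List (α ⊕ β) → ℕ → List α
  | [], _ => []
  | .inl a :: l, 0 => a :: block l 0
  | .inl _ :: l, j + 1 => block l (j + 1)
  | .inr _ :: _, 0 => []
  | .inr _ :: l, j + 1 => block l j

theorem inl_mem_of_mem_block {α β : Type*} {a : α} {l : List (α ⊕ β)} {j : ℕ}
    (h : a ∈ block l j) : Sum.inl a ∈ l := by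
  induction l generalizing j with
  | nil => simp [block] at h
  | cons x l ih =>
    rcases x with b | b <;> rcases j with _ | j <;> simp only [block] at h
    · rcases List.mem_cons.1 h with rfl | h
      · exact List.mem_cons_self
      · exact List.mem_cons_of_mem _ (ih h)
    · exact List.mem_cons_of_mem _ (ih h)
    · simp at h
    · exact List.mem_cons_of_mem _ (ih h)

theorem sum_length_block_le {α β : Type*} (l : List (α ⊕ β)) (n : ℕ) :
    ∑ j ∈ Finset.range n, (block l j).length ≤ l.countP Sum.isLeft := by
  induction l generalizing n with
  | nil => simp [block]
  | cons x l ih =>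
    rcases n with _ | n
    · simp
    rw [Finset.sum_range_succ']
    rcases x with b | b
    · have := ih (n + 1)
      rw [Finset.sum_range_succ'] at this
      simp only [block, List.length_cons, List.countP_cons, Sum.isLeft_inl, if_true]
      omega
    · simpa [block] using ih n

theorem flatMap_eq_interleave_block {α β γ : Type*} (φ : α → List γ) (env : β → List γ)
    (l : List (α ⊕ β)) :
    l.flatMap (Sum.elim φ env) =
      interleave (fun j => (block l j).flatMap φ)
        ((l.filterMap Sum.getRight?).map env) := by
  induction l with
  | nil => simp [interleave, block]
  | cons x l ih =>
    rcases x with b | b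
    · rw [List.flatMap_cons, ih, List.filterMap_cons_none (by rfl)]
      rcases (l.filterMap Sum.getRight?) with _ | ⟨y, ys⟩ <;> simp [interleave, block]
    · rw [List.flatMap_cons, ih, List.filterMap_cons_some (by rfl)]
      simp [interleave, block]

namespace PTree

variable {L N : Type}

theorem induction_on {motive : PTree L N → Prop} (t : PTree L N)
    (leaf : motive .leaf) (param : ∀ i, motive (.param i))
    (term : ∀ a l r, motive l → motive r → motive (.term a l r))
    (nt : ∀ B ts, (∀ t ∈ ts, motive t) → motive (.nt B ts)) : motive t :=
  match t with
  | .leaf => leaf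
  | .param i => param i
  | .term a l r =>
    term a l r (induction_on l leaf param term nt) (induction_on r leaf param term nt)
  | .nt B ts => nt B ts (fun t _ => induction_on t leaf param term nt)

theorem paramList_nt (B : N) (ts : List (PTree L N)) :
    paramList (.nt B ts) = (ts.map paramList).flatten := by
  rw [paramList]; simp

theorem nodeCount_nt (B : N) (ts : List (PTree L N)) :
    nodeCount (.nt B ts) = 1 + (ts.map nodeCount).sum := by
  rw [nodeCount]; simp

theorem subst_nt (env : List (PTree L N)) (B : N) (ts : List (PTree L N)) :
    subst env (.nt B ts) = .nt B (ts.map (subst env)) := by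
  rw [subst]; simp

theorem one_le_nodeCount (t : PTree L N) : 1 ≤ nodeCount t := by
  cases t <;> rw [nodeCount] <;> omega

/-- The traversal string of a tree over brackets and parameters, in which a node labeled by
a nonterminal `B` contributes `f B 0` before its first child and `f B j` after its
`j`-th child. -/
def tokens {V : Type} (f : N → ℕ → V) : PTree L N → List (((L × Bool) ⊕ V) ⊕ ℕ)
  | .leaf => []
  | .param i => [.inr i]
  | .term a l r =>
    .inl (.inl (a, false)) :: (tokens f l ++ tokens f r ++ [.inl (.inl (a, true))])
  | .nt B ts =>
    interleave (fun j => [.inl (.inr (f B j))]) (ts.attach.map (fun t => tokens f t.1))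
decreasing_by
  all_goals simp_wf
  all_goals try omega
  all_goals (have := List.sizeOf_lt_of_mem t.2; omega)

variable {V : Type} (f : N → ℕ → V)

theorem tokens_nt (B : N) (ts : List (PTree L N)) :
    tokens f (.nt B ts) = interleave (fun j => [.inl (.inr (f B j))]) (ts.map (tokens f)) := by
  rw [tokens]; simp

theorem filterMap_tokens (t : PTree L N) :
    (tokens f t).filterMap Sum.getRight? = paramList t := by
  induction t using induction_on with
  | leaf => simp [tokens, paramList]
  | param i => simp [tokens, paramList]
  | term a l r hl hr =>
    rw [tokens, paramList, List.filterMap_cons_none (by rfl), List.filterMap_append,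
      List.filterMap_append, hl, hr]
    simp
  | nt B ts ih =>
    rw [tokens_nt, paramList_nt, filterMap_interleave _ _ (by simp), List.map_map]
    exact congrArg _ (List.map_congr_left ih)

theorem countP_tokens_lt (t : PTree L N) :
    (tokens f t).countP Sum.isLeft < 2 * nodeCount t := by
  induction t using induction_on with
  | leaf => simp [tokens, nodeCount]
  | param i => simp [tokens, nodeCount]
  | term a l r hl hr =>
    simp only [tokens, nodeCount, List.countP_cons, List.countP_append, List.countP_nil,
      Sum.isLeft_inl, if_true]
    omega
  | nt B ts ih =>
    rw [tokens_nt, nodeCount_nt, countP_interleave _ _ (by simp), List.map_map]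
    have : (ts.map ((fun x => x.countP Sum.isLeft + 1) ∘ tokens f)).sum ≤
        (ts.map (fun t => 2 * nodeCount t)).sum :=
      List.sum_le_sum ih
    rw [List.sum_map_mul_left] at this
    omega

theorem countP_tokens_le {t : PTree L N} (ht : ∀ C, t ≠ .nt C []) :
    (tokens f t).countP Sum.isLeft ≤ 3 * (nodeCount t - 1) := by
  have h := countP_tokens_lt f t
  cases t with
  | leaf => simp [tokens]
  | param i => simp [tokens]
  | term a l r =>
    have := one_le_nodeCount l
    rw [nodeCount] at h ⊢
    omega
  | nt B ts =>
    rcases ts with _ | ⟨t, ts⟩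
    · exact absurd rfl (ht B)
    have := one_le_nodeCount t
    rw [nodeCount_nt, List.map_cons, List.sum_cons] at h ⊢
    omega

theorem exists_occurs_of_mem_tokens {v : V} {t : PTree L N}
    (h : Sum.inl (Sum.inr v) ∈ tokens f t) : ∃ B j, Occurs B t ∧ v = f B j := by
  induction t using induction_on with
  | leaf => simp [tokens] at h
  | param i => simp [tokens] at h
  | term a l r hl hr =>
    simp only [tokens, List.mem_cons, List.mem_append, List.not_mem_nil, or_false] at h
    rcases h with h | (h | h) | h
    · simp at h
    · obtain ⟨B, j, hB, hv⟩ := hl h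
      exact ⟨B, j, .term_left a hB, hv⟩
    · obtain ⟨B, j, hB, hv⟩ := hr h
      exact ⟨B, j, .term_right a hB, hv⟩
    · simp at h
  | nt B ts ih =>
    rw [tokens_nt] at h
    rcases mem_interleave h with ⟨j, hj⟩ | ⟨x, hx, hvx⟩
    · exact ⟨B, j, .here ts, by simpa using hj⟩
    · obtain ⟨t, ht, rfl⟩ := List.mem_map.1 hx
      obtain ⟨C, j, hC, hv⟩ := ih t ht hvx
      exact ⟨C, j, .nt B ht hC, hv⟩

/-- The string obtained from the traversal string of a tree by replacing every `v : V`
by `w v` and every parameter by its value under `env`. -/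
def eval (w : V → List (L × Bool)) (env : ℕ → List (L × Bool)) (t : PTree L N) :
    List (L × Bool) :=
  (tokens f t).flatMap (Sum.elim (Sum.elim (fun a => [a]) w) env)

variable (w : V → List (L × Bool)) (env : ℕ → List (L × Bool))

theorem eval_param (i : ℕ) : eval f w env (.param i : PTree L N) = env i := by
  simp [eval, tokens]

theorem eval_term (a : L) (l r : PTree L N) :
    eval f w env (.term a l r) =
      (a, false) :: (eval f w env l ++ eval f w env r ++ [(a, true)]) := by
  simp [eval, tokens]

theorem eval_nt (B : N) (ts : List (PTree L N)) :
    eval f w env (.nt B ts) =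
      interleave (fun j => w (f B j)) (ts.map (eval f w env)) := by
  rw [eval, tokens_nt, flatMap_interleave, List.map_map]
  simp only [List.flatMap_singleton, Sum.elim_inl, Sum.elim_inr]
  rfl

theorem eval_eq_interleave (t : PTree L N) :
    eval f w env t =
      interleave (fun j => (block (tokens f t) j).flatMap (Sum.elim (fun a => [a]) w))
        ((paramList t).map env) := by
  rw [eval, flatMap_eq_interleave_block, filterMap_tokens]

theorem eval_subst (ts : List (PTree L N)) (t : PTree L N) :
    eval f w env (subst ts t) =
      eval f w (fun i => eval f w env (ts.getD (i - 1) .leaf)) t := by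
  induction t using induction_on with
  | leaf => simp [subst, eval, tokens]
  | param i => rw [subst, eval_param]
  | term a l r hl hr => rw [subst, eval_term, eval_term, hl, hr]
  | nt B us ih =>
    rw [subst_nt, eval_nt, eval_nt, List.map_map]
    exact congrArg _ (List.map_congr_left ih)

theorem Ground.eval_eq_serialize {t : PTree L N} (ht : Ground t) :
    eval f w env t = t.serialize := by
  induction ht with
  | leaf => simp [eval, tokens, serialize]
  | term a _ _ hl hr => rw [eval_term, serialize, hl, hr]

theorem ArityOk.subst {rank : N → ℕ} {ts : List (PTree L N)}
    (hts : ∀ t ∈ ts, ArityOk rank t) {t : PTree L N} (ht : ArityOk rank t) :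
    ArityOk rank (PTree.subst ts t) := by
  induction ht with
  | leaf => rw [PTree.subst]; exact .leaf
  | param i =>
    rw [PTree.subst, List.getD_eq_getElem?_getD]
    rcases h : ts[i - 1]? with _ | t
    · exact .leaf
    · exact hts t (List.mem_of_getElem? h)
  | term a _ _ hl hr => rw [PTree.subst]; exact .term a hl hr
  | nt A hlen _ ih =>
    rw [subst_nt]
    refine .nt A (by simpa using hlen) fun t ht => ?_
    obtain ⟨u, hu, rfl⟩ := List.mem_map.1 ht
    exact ih u hu

end PTree

namespace SLT

variable {L N : Type} (G : SLT L N)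

open PTree

theorem Rw.arityOk {G : SLT L N} {t t' : PTree L N} (h : Rw G t t')
    (ht : ArityOk G.rank t) : ArityOk G.rank t' := by
  induction h with
  | head A ts =>
    cases ht with
    | nt _ _ hts => exact (G.arity A).subst hts
  | term_left a r _ ih =>
    cases ht with
    | term _ hl hr => exact .term a (ih hl) hr
  | term_right a l _ ih =>
    cases ht with
    | term _ hl hr => exact .term a hl (ih hr)
  | nt_child B u v _ ih =>
    cases ht with
    | nt _ hlen hts =>
      refine .nt B (by simpa using hlen) fun s hs => ?_
      simp only [List.mem_append, List.mem_cons] at hs hts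
      rcases hs with hs | rfl | hs
      · exact hts s (.inl hs)
      · exact ih (hts _ (.inr (.inl rfl)))
      · exact hts s (.inr (.inr hs))

variable {V : Type} {f : N → ℕ → V} {w : V → List (L × Bool)}

theorem Rw.eval_eq {G : SLT L N}
    (hw : ∀ A env, eval f w env (G.P A) =
      interleave (fun j => w (f A j)) ((List.range' 1 (G.rank A)).map env))
    (env : ℕ → List (L × Bool)) {t t' : PTree L N} (h : Rw G t t')
    (ht : ArityOk G.rank t) : eval f w env t' = eval f w env t := by
  induction h with
  | head A ts =>
    cases ht with
    | nt _ hlen hts =>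
      rw [eval_subst, hw, eval_nt]
      congr 1
      refine List.ext_getElem (by simp [hlen]) fun i h₁ h₂ => ?_
      have hi : i < ts.length := by simpa using h₂
      simp [hi]
  | term_left a r _ ih =>
    cases ht with
    | term _ hl hr => rw [eval_term, eval_term, ih hl]
  | term_right a l _ ih =>
    cases ht with
    | term _ hl hr => rw [eval_term, eval_term, ih hr]
  | nt_child B u v _ ih =>
    cases ht with
    | nt _ hlen hts =>
      rw [eval_nt, eval_nt, List.map_append, List.map_cons, List.map_append, List.map_cons,
        ih (hts _ (by simp))]

theorem eval_eq_of_reflTransGen {G : SLT L N}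
    (hw : ∀ A env, eval f w env (G.P A) =
      interleave (fun j => w (f A j)) ((List.range' 1 (G.rank A)).map env))
    (env : ℕ → List (L × Bool)) {t t' : PTree L N}
    (h : Relation.ReflTransGen (Rw G) t t') (ht : ArityOk G.rank t) :
    eval f w env t' = eval f w env t := by
  have key : ArityOk G.rank t' ∧ eval f w env t' = eval f w env t := by
    induction h with
    | refl => exact ⟨ht, rfl⟩
    | tail _ hstep ih =>
      exact ⟨hstep.arityOk ih.1, (hstep.eval_eq hw env ih.1).trans ih.2⟩
  exact key.2

/-- Chain productions `A → C` can be followed to their end. -/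
theorem exists_chain_end [Finite N] : ∃ ρ : N → N,
    (∀ A C, G.P A = .nt C [] → ρ A = ρ C) ∧
    (∀ A, (∀ C, G.P A ≠ .nt C []) → ρ A = A) ∧
    ∀ A, Relation.ReflTransGen (fun X Y => Occurs Y (G.P X)) A (ρ A) := by
  classical
  have wf := wellFounded_of_acyclic G.acyclic
  have hocc : ∀ {A C}, G.P A = .nt C [] → Occurs C (G.P A) := fun h => by
    rw [h]; exact .here []
  let F : (A : N) → ((B : N) → Occurs B (G.P A) → N) → N := fun A rec =>
    if h : ∃ C, G.P A = .nt C [] then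
      rec h.choose (hocc h.choose_spec)
    else A
  have hchain : ∀ A C, G.P A = .nt C [] → wf.fix F A = wf.fix F C := by
    intro A C hC
    have h : ∃ C, G.P A = .nt C [] := ⟨C, hC⟩
    have hch : h.choose = C := (PTree.nt.inj (h.choose_spec.symm.trans hC)).1
    rw [wf.fix_eq]
    simp only [F, dif_pos h]
    rw [hch]
  have hend : ∀ A, (∀ C, G.P A ≠ .nt C []) → wf.fix F A = A := by
    intro A hA
    rw [wf.fix_eq]
    exact dif_neg (by simpa using hA)
  refine ⟨wf.fix F, hchain, hend, fun A => ?_⟩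
  induction A using wf.induction with
  | _ A ih =>
    by_cases h : ∃ C, G.P A = .nt C []
    · obtain ⟨C, hC⟩ := h
      rw [hchain A C hC]
      exact .head (hocc hC) (ih C (hocc hC))
    · rw [hend A (by simpa using h)]

theorem rank_eq_zero_of_chain {A C : N} (h : G.P A = .nt C []) : G.rank A = 0 := by
  have := congrArg List.length (G.params A)
  rw [h, paramList_nt] at this
  simpa using this.symm

end SLT

namespace SLP

variable {Γ V : Type} (H : SLP Γ V)

theorem Rw.append_context {H : SLP Γ V} {s t : List (Γ ⊕ V)} (h : Rw H s t)
    (u v : List (Γ ⊕ V)) : Rw H (u ++ s ++ v) (u ++ t ++ v) := by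
  cases h with
  | step p x q =>
    have := Rw.step (H := H) (u ++ p) x (q ++ v)
    simpa using this

theorem reflTransGen_append {H : SLP Γ V} {s s' t t' : List (Γ ⊕ V)}
    (hs : Relation.ReflTransGen (Rw H) s s') (ht : Relation.ReflTransGen (Rw H) t t') :
    Relation.ReflTransGen (Rw H) (s ++ t) (s' ++ t') := by
  refine (hs.lift (· ++ t) fun a b h => ?_).trans (ht.lift (s' ++ ·) fun a b h => ?_)
  · simpa using h.append_context [] t
  · simpa using h.append_context s' []

theorem exists_value [Finite V] : ∃ w : V → List Γ,
    (∀ v, w v = (H.P v).flatMap (Sum.elim (fun a => [a]) w)) ∧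
    ∀ v, Relation.ReflTransGen (Rw H) [Sum.inr v] ((w v).map Sum.inl) := by
  have wf := wellFounded_of_acyclic H.acyclic
  let F : (v : V) → ((u : V) → Sum.inr u ∈ H.P v → List Γ) → List Γ := fun v rec =>
    (H.P v).attach.flatMap fun x =>
      match x with
      | ⟨.inl a, _⟩ => [a]
      | ⟨.inr u, h⟩ => rec u h
  have hw : ∀ v, wf.fix F v = (H.P v).flatMap (Sum.elim (fun a => [a]) (wf.fix F)) := by
    intro v
    rw [wf.fix_eq]
    conv_rhs => rw [← List.attach_map_subtype_val (H.P v), List.flatMap_map]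
    refine congrArg (fun φ => List.flatMap φ (H.P v).attach) (funext fun x => ?_)
    rcases x with ⟨a | u, h⟩ <;> rfl
  refine ⟨wf.fix F, hw, fun v => ?_⟩
  induction v using wf.induction with
  | _ v ih =>
    have expand : ∀ l : List (Γ ⊕ V), l ⊆ H.P v →
        Relation.ReflTransGen (Rw H) l
          ((l.flatMap (Sum.elim (fun a => [a]) (wf.fix F))).map Sum.inl) := by
      intro l
      induction l with
      | nil => intro _; exact .refl
      | cons x l ihl =>
        intro hl
        rw [List.flatMap_cons, List.map_append, ← List.singleton_append]
        refine reflTransGen_append ?_ (ihl fun y hy => hl (List.mem_cons_of_mem _ hy))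
        rcases x with a | u
        · exact .refl
        · exact ih u (hl List.mem_cons_self)
    have hstep : Rw H [Sum.inr v] (H.P v) := by simpa using Rw.step (H := H) [] v []
    have := expand (H.P v) (List.Subset.refl _)
    rw [← hw v] at this
    exact .head hstep this

end SLP

/-- There is a constant `c > 0` such that for every SLT
grammar `G` there is a straight-line program of size `O(|G|)` that generates
the serialization (the pre-order traversal string of opening and closing
labeled brackets) of the tree derived by `G`. -/
theorem slp_for_serialization :
    ∃ c : ℕ, 0 < c ∧
      ∀ (L N : Type) [Fintype N] (G : SLT L N),
        ∃ (m : ℕ) (H : SLP (L × Bool) (Fin m)),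
          SLP.size H ≤ c * (SLT.size G + 1) ∧
          ∀ t : PTree L N, PTree.Ground t →
            Relation.ReflTransGen (SLT.Rw G) (G.P G.start) t →
            H.Generates t.serialize := by
  classical
  refine ⟨3, by norm_num, fun L N _ G => ?_⟩
  obtain ⟨ρ, hchain, hend, hreach⟩ := G.exists_chain_end
  obtain ⟨K, hK⟩ : ∃ K, ∀ A, G.rank A ≤ K :=
    ⟨Finset.univ.sup G.rank, fun A => Finset.le_sup (Finset.mem_univ A)⟩
  let e := Fintype.equivFin (N × Fin (K + 1))
  let f : N → ℕ → Fin (Fintype.card (N × Fin (K + 1))) := fun B j => e (ρ B, Fin.ofNat (K + 1) j)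
  let R : N × Fin (K + 1) → List ((L × Bool) ⊕ Fin (Fintype.card (N × Fin (K + 1)))) := fun x =>
    if ∃ C, G.P x.1 = .nt C [] then [] else block (PTree.tokens f (G.P x.1)) x.2
  let H : SLP (L × Bool) (Fin (Fintype.card (N × Fin (K + 1)))) :=
    { start := f G.start 0
      P := fun v => R (e.symm v)
      acyclic := fun v hv => G.acyclic (e.symm v).1 <| by
        refine Relation.TransGen.lift' (fun v => (e.symm v).1) (fun x y hxy => ?_) v v hv
        by_cases h : ∃ C, G.P (e.symm x).1 = .nt C []
        · simp [R, h] at hxy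
        · simp only [R, if_neg h] at hxy
          obtain ⟨B, j, hB, rfl⟩ :=
            PTree.exists_occurs_of_mem_tokens f (inl_mem_of_mem_block hxy)
          simpa [f, Function.onFun] using Relation.TransGen.head' hB (hreach B) }
  refine ⟨_, H, ?_, fun t ht hder => ?_⟩
  · have hsum : SLP.size H = ∑ A, ∑ j, (R (A, j)).length := by
      rw [← Fintype.sum_prod_type (fun x => (R x).length), SLP.size]
      exact e.symm.sum_comp fun x => (R x).length
    have hrow : ∀ A, ∑ j, (R (A, j)).length ≤ 3 * (PTree.nodeCount (G.P A) - 1) := by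
      intro A
      by_cases h : ∃ C, G.P A = .nt C []
      · simp [R, h]
      · simp only [R, if_neg h]
        rw [Fin.sum_univ_eq_sum_range
          (fun j => (block (PTree.tokens f (G.P A)) j).length) (K + 1)]
        exact (sum_length_block_le _ _).trans (PTree.countP_tokens_le f (by simpa using h))
    calc SLP.size H ≤ ∑ A, 3 * (PTree.nodeCount (G.P A) - 1) :=
          hsum.trans_le (Finset.sum_le_sum fun A _ => hrow A)
      _ = 3 * SLT.size G := by rw [SLT.size, Finset.mul_sum]
      _ ≤ 3 * (SLT.size G + 1) := by omega
  · obtain ⟨w, hw, hgen⟩ := H.exists_value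
    have hprod : ∀ A env, PTree.eval f w env (G.P A) =
        interleave (fun j => w (f A j)) ((List.range' 1 (G.rank A)).map env) := by
      intro A env
      by_cases h : ∃ C, G.P A = .nt C []
      · obtain ⟨C, hC⟩ := h
        rw [G.rank_eq_zero_of_chain hC, hC, PTree.eval_nt]
        simp [interleave, f, hchain A C hC]
      · rw [PTree.eval_eq_interleave, G.params]
        refine interleave_congr fun j hj => ?_
        have hjK : j < K + 1 := by
          have := hK A
          simp only [List.length_map, List.length_range'] at hj
          omega
        rw [hw (f A j)]
        simp [H, R, f, hend A (by simpa using h), if_neg h, Nat.mod_eq_of_lt hjK]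
    have hstart : w H.start = t.serialize := by
      have h := SLT.eval_eq_of_reflTransGen hprod (fun _ => []) hder (G.arity _)
      rw [ht.eval_eq_serialize, hprod, G.rank_start] at h
      exact h.symm
    rw [← hstart]
    exact hgen H.start
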